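/- The set S := {(g, w) ∈ SL(2,ℝ) × ℝ² : there exists ε > 0 such that ‖b_t g m‖ ≥ ε for all t ≥ 0 and all m ∈ ℤ² \ {0}} is thick; that is, for every open set U ⊆ M₂(ℝ) × ℝ² with U ∩ (SL(2,ℝ) × ℝ²) ≠ ∅, the Hausdorff dimension of S ∩ U equals 5. -/

import Mathlib

/-- Membership of `g` (as a `2×2` array) in `SL(2,ℝ)`. -/
def isSL2 (g : Fin 2 → Fin 2 → ℝ) : Prop :=
  g 0 0 * g 1 1 - g 0 1 * g 1 0 = 1

/-- Matrix-vector multiplication for `2×2` arrays. -/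
def matVec (g : Fin 2 → Fin 2 → ℝ) (y : Fin 2 → ℝ) : Fin 2 → ℝ :=
  fun i => g i 0 * y 0 + g i 1 * y 1

/-- The product `b_t g` where `b_t = diag(e^t, e^{−t})`. -/
noncomputable def btMul (t : ℝ) (g : Fin 2 → Fin 2 → ℝ) : Fin 2 → Fin 2 → ℝ :=
  fun i j => (if i = 0 then Real.exp t else Real.exp (-t)) * g i j

/-- The Euclidean norm on `ℝ²`. -/
noncomputable def euclNorm2 (y : Fin 2 → ℝ) : ℝ :=
  Real.sqrt (y 0 ^ 2 + y 1 ^ 2)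

section HausdorffLowerBound

open MeasureTheory Set
open scoped ENNReal NNReal

/-- If `F` does not contract the `i`-th coordinate by more than a power `e i`, then the image of a
non-null set has Hausdorff dimension at least `∑ i, e i`. -/
theorem sum_le_dimH_of_edist_le {ι X : Type*} [Fintype ι] [EMetricSpace X]
    {s : Set X} {B : Set (ι → ℝ)} (hB : volume B ≠ 0) {F : (ι → ℝ) → X} (hF : MapsTo F B s)
    {e : ι → ℝ≥0} {C : ℝ≥0}
    (h : ∀ p ∈ B, ∀ p' ∈ B, ∀ i, edist (p i) (p' i) ≤ C * edist (F p) (F p') ^ (e i : ℝ)) :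
    ((∑ i, e i : ℝ≥0) : ℝ≥0∞) ≤ dimH s := by
  borelize X
  have prod_rpow (x : ℝ≥0∞) :
      ∏ i, x ^ (e i : ℝ) = x ^ ((∑ i, e i : ℝ≥0) : ℝ) := by
    rw [NNReal.coe_sum]
    induction (Finset.univ : Finset ι) using Finset.cons_induction with
    | empty => simp
    | cons i t hi ih =>
      rw [Finset.prod_cons, Finset.sum_cons, ih, ENNReal.rpow_add_of_nonneg]
      · positivity
      · positivity
  have bound (t : Set X) : volume (B ∩ F ⁻¹' t) ≤
      (C : ℝ≥0∞) ^ Fintype.card ι *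
        ⨆ _ : t.Nonempty, Metric.ediam t ^ ((∑ i, e i : ℝ≥0) : ℝ) := by
    rcases t.eq_empty_or_nonempty with rfl | ht
    · simp
    rw [iSup_pos ht, ← prod_rpow, ← Finset.card_univ, ← Finset.prod_const,
      ← Finset.prod_mul_distrib]
    refine (Real.volume_pi_le_prod_diam _).trans (Finset.prod_le_prod' fun i _ => ?_)
    refine Metric.ediam_le ?_
    rintro _ ⟨p, hp, rfl⟩ _ ⟨p', hp', rfl⟩
    refine (h p hp.1 p' hp'.1 i).trans ?_
    gcongr
    exact Metric.edist_le_ediam_of_mem hp.2 hp'.2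
  have key : volume B ≤ (C : ℝ≥0∞) ^ Fintype.card ι * μH[((∑ i, e i : ℝ≥0) : ℝ)] s := by
    rw [Measure.hausdorffMeasure_apply]
    refine le_trans ?_ (mul_le_mul_right (le_iSup₂ (1 : ℝ≥0∞) one_pos) _)
    have hC : (C : ℝ≥0∞) ^ Fintype.card ι ≠ ∞ := by finiteness
    rcases eq_or_ne ((C : ℝ≥0∞) ^ Fintype.card ι) 0 with h0 | h0
    · have : volume B ≤ 0 := by
        calc volume B = volume (B ∩ F ⁻¹' univ) := by simp
          _ ≤ _ := bound univ
          _ = 0 := by rw [h0, zero_mul]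
      exact absurd (le_antisymm this bot_le) hB
    rw [← ENNReal.div_le_iff' h0 hC]
    refine le_iInf fun t => le_iInf fun hst => le_iInf fun _ => ?_
    rw [ENNReal.div_le_iff' h0 hC, ← ENNReal.tsum_mul_left]
    calc volume B ≤ volume (⋃ n, B ∩ F ⁻¹' t n) := by
          refine measure_mono fun p hp => ?_
          obtain ⟨n, hn⟩ := mem_iUnion.1 (hst (hF hp))
          exact mem_iUnion.2 ⟨n, hp, hn⟩
      _ ≤ ∑' n, volume (B ∩ F ⁻¹' t n) := measure_iUnion_le _
      _ ≤ _ := ENNReal.tsum_le_tsum fun n => bound (t n)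
  refine le_dimH_of_hausdorffMeasure_ne_zero fun h0 => hB ?_
  rw [h0, mul_zero] at key
  exact le_antisymm key bot_le

end HausdorffLowerBound

section BadlyApproximable

open Set

/-- Among the subintervals of length `L / R ^ (n + 1)` of an interval of length `L / R ^ n`,
all but two consecutive ones stay away from the fractions of denominator `q` with
`R ^ (n - 1) ≤ 2 * L * q ^ 2 < R ^ n`. -/
theorem exists_subintervals_avoiding_rationals (α : ℝ) {L R : ℝ} (hL : 0 < L) (hR : 1 ≤ R)
    (n : ℕ) (a : ℤ) :
    ∃ k : ℤ, ∀ m : ℤ, a * R ≤ m → m + 1 ≤ a * R + R → (m < k ∨ k + 2 ≤ m) →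
      ∀ x : ℝ, α + m * (L / R ^ (n + 1)) ≤ x → x ≤ α + (m + 1) * (L / R ^ (n + 1)) →
      ∀ p q : ℤ, 1 ≤ q → R ^ n ≤ 2 * L * q ^ 2 * R → 2 * L * q ^ 2 < R ^ n →
        1 / (4 * R ^ 2) / (q : ℝ) ^ 2 ≤ |x - p / q| := by
  set ℓ := L / R ^ (n + 1) with hℓ
  have hR0 : 0 < R := by linarith
  have hℓ0 : 0 < ℓ := by positivity
  have hRn : 0 < R ^ n := by positivity
  have hℓR : L = ℓ * R ^ n * R := by rw [hℓ, pow_succ]; field_simp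
  have radius (q : ℤ) (hq : 1 ≤ q) (h : R ^ n ≤ 2 * L * q ^ 2 * R) :
      1 / (4 * R ^ 2) / (q : ℝ) ^ 2 ≤ ℓ / 2 := by
    have hq0 : (0 : ℝ) < q := by exact_mod_cast hq
    rw [div_div, div_le_iff₀ (by positivity)]
    have : R ^ n * 1 ≤ R ^ n * (ℓ / 2 * (4 * R ^ 2 * q ^ 2)) := by
      calc R ^ n * 1 ≤ 2 * (ℓ * R ^ n * R) * q ^ 2 * R := by rw [← hℓR]; simpa using h
        _ = _ := by ring
    exact le_of_mul_le_mul_left this hRn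
  by_cases hbad : ∃ m : ℤ, a * R ≤ m ∧ m + 1 ≤ a * R + R ∧
      ∃ x : ℝ, α + m * ℓ ≤ x ∧ x ≤ α + (m + 1) * ℓ ∧
      ∃ p q : ℤ, 1 ≤ q ∧ R ^ n ≤ 2 * L * q ^ 2 * R ∧ 2 * L * q ^ 2 < R ^ n ∧
        |x - p / q| < 1 / (4 * R ^ 2) / (q : ℝ) ^ 2
  swap
  · push Not at hbad
    exact ⟨0, fun m h1 h2 _ x h3 h4 p q h5 h6 h7 => hbad m h1 h2 x h3 h4 p q h5 h6 h7⟩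
  obtain ⟨m₀, hm₀, hm₀', x₀, hx₀, hx₀', p₀, q₀, hq₀, hq₀R, hq₀R', h₀⟩ := hbad
  set ξ : ℝ := p₀ / q₀ with hξ
  replace h₀ := abs_lt.1 (h₀.trans_le (radius q₀ hq₀ hq₀R))
  refine ⟨⌈(ξ - α) / ℓ - 3 / 2⌉, fun m hm hm' hmk x hx hx' p q hq hqR hqR' => ?_⟩
  by_contra! hlt
  replace hlt := abs_lt.1 (hlt.trans_le (radius q hq hqR))
  have hq0 : (0 : ℝ) < q := by exact_mod_cast hq
  have hq₀0 : (0 : ℝ) < q₀ := by exact_mod_cast hq₀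
  have heq : (p : ℝ) / q = ξ := by
    by_contra hne
    have hcross : (1 : ℝ) ≤ |(p * q₀ - p₀ * q : ℝ)| := by
      have : p * q₀ - p₀ * q ≠ 0 := by
        intro h0
        apply hne
        rw [hξ, div_eq_div_iff hq0.ne' hq₀0.ne']
        have := sub_eq_zero.1 h0
        exact_mod_cast this
      exact_mod_cast Int.one_le_abs this
    have hqq : 2 * L * (q * q₀) < R ^ n := by
      by_contra! hge
      have h1 : (2 * L * q ^ 2) * (2 * L * q₀ ^ 2) < R ^ n * R ^ n := by
        apply mul_lt_mul'' hqR' hq₀R' <;> positivity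
      have h2 : R ^ n * R ^ n ≤ (2 * L * (q * q₀)) * (2 * L * (q * q₀)) := by gcongr
      linarith [show (2 * L * q ^ 2) * (2 * L * q₀ ^ 2)
        = (2 * L * (q * q₀)) * (2 * L * (q * q₀)) by ring]
    have hdiff : |(p * q₀ - p₀ * q : ℝ)| = |(p : ℝ) / q - ξ| * (q * q₀) := by
      rw [hξ, div_sub_div _ _ hq0.ne' hq₀0.ne', abs_div, abs_of_pos (mul_pos hq0 hq₀0)]
      field_simp
    have hclose : |(p : ℝ) / q - ξ| ≤ 2 * R * ℓ := by
      have e1 : m * ℓ ≤ (a * R + R - 1) * ℓ := by gcongr; linarith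
      have e2 : m₀ * ℓ ≤ (a * R + R - 1) * ℓ := by gcongr; linarith
      have e3 : a * R * ℓ ≤ m * ℓ := by gcongr
      have e4 : a * R * ℓ ≤ m₀ * ℓ := by gcongr
      have e5 : 1 * ℓ ≤ R * ℓ := by gcongr
      rw [abs_le]
      constructor <;> linarith
    have : R ^ n * 1 ≤ 2 * L * (q * q₀) := by
      calc R ^ n * 1 ≤ R ^ n * (2 * R * ℓ * (q * q₀)) := by
            gcongr
            rw [hdiff] at hcross
            exact hcross.trans (by gcongr)
        _ = 2 * (ℓ * R ^ n * R) * (q * q₀) := by ring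
        _ = _ := by rw [← hℓR]
    linarith
  rw [heq] at hlt
  have hmul : (ξ - α) / ℓ * ℓ = ξ - α := div_mul_cancel₀ _ hℓ0.ne'
  rcases hmk with hmk | hmk
  · have h1 := Int.lt_ceil.1 hmk
    have h2 := mul_le_mul_of_nonneg_right h1.le hℓ0.le
    linarith
  · have h1 := (Int.le_ceil ((ξ - α) / ℓ - 3 / 2))
    have h2 : ((⌈(ξ - α) / ℓ - 3 / 2⌉ : ℤ) : ℝ) + 2 ≤ m := by exact_mod_cast hmk
    have h3 : ((ξ - α) / ℓ + 1 / 2) * ℓ ≤ m * ℓ := by gcongr; linarith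
    linarith

/-- The position, among all intervals of level `n`, of the `k`-th interval of a Cantor construction
in which each interval of level `n` at position `a` is split into `M + 2` pieces, the pieces at
positions `K n a` and `K n a + 1` being discarded. -/
def cantorPosition (M : ℤ) (K : ℕ → ℤ → ℤ) : ℕ → ℤ → ℤ
  | 0, k => k
  | n + 1, k =>
    let a := cantorPosition M K n (k / M)
    let m := a * (M + 2) + k % M
    if m < K n a then m else m + 2

variable {M : ℤ} {K : ℕ → ℤ → ℤ}

theorem cantorPosition_succ_mem (hM : 0 < M) (n : ℕ) (k : ℤ) :
    cantorPosition M K n (k / M) * (M + 2) ≤ cantorPosition M K (n + 1) k ∧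
      cantorPosition M K (n + 1) k + 1 ≤ cantorPosition M K n (k / M) * (M + 2) + (M + 2) := by
  have h1 := Int.emod_nonneg k hM.ne'
  have h2 := Int.emod_lt_of_pos k hM
  simp only [cantorPosition]
  split_ifs <;> constructor <;> linarith

theorem cantorPosition_succ_avoids (n : ℕ) (k : ℤ) :
    cantorPosition M K (n + 1) k < K n (cantorPosition M K n (k / M)) ∨
      K n (cantorPosition M K n (k / M)) + 2 ≤ cantorPosition M K (n + 1) k := by
  simp only [cantorPosition]
  split_ifs <;> omega

theorem strictMono_cantorPosition (hM : 0 < M) (n : ℕ) : StrictMono (cantorPosition M K n) := by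
  induction n with
  | zero => exact fun _ _ h => h
  | succ n ih =>
    intro k k' hkk
    rcases (Int.ediv_le_ediv hM hkk.le).eq_or_lt with h | h
    · have h1 := Int.emod_add_mul_ediv k M
      have h2 := Int.emod_add_mul_ediv k' M
      rw [← h] at h2
      have h3 : k % M < k' % M := by linarith
      simp only [cantorPosition, ← h]
      split_ifs <;> linarith
    · have h1 := (cantorPosition_succ_mem (K := K) hM n k).2
      have h2 := (cantorPosition_succ_mem (K := K) hM n k').1
      have h3 : cantorPosition M K n (k / M) + 1 ≤ cantorPosition M K n (k' / M) := ih h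
      have h4 := mul_le_mul_of_nonneg_right h3 (by linarith : 0 ≤ M + 2)
      linarith

open Filter Topology in
theorem exists_nat_rpow_le (b : ℝ) {s : ℝ} (hs0 : 0 ≤ s) (hs1 : s < 1) :
    ∃ M : ℕ, 2 ≤ M ∧ b ≤ M ∧ ((M : ℝ) + 2) ^ s ≤ M := by
  have h1 : ∀ᶠ x : ℝ in atTop, 2 ≤ x ^ (1 - s) :=
    (tendsto_rpow_atTop (by linarith)).eventually_ge_atTop 2
  obtain ⟨M, hM1, hM2, hM3⟩ := ((tendsto_natCast_atTop_atTop (R := ℝ)).eventually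
    (h1.and ((eventually_ge_atTop 2).and (eventually_ge_atTop b)))).exists
  refine ⟨M, by exact_mod_cast hM2, hM3, ?_⟩
  have hM0 : (0 : ℝ) < M := by linarith
  calc ((M : ℝ) + 2) ^ s ≤ (2 * M) ^ s := by gcongr; linarith
    _ = 2 ^ s * (M : ℝ) ^ s := Real.mul_rpow (by norm_num) hM0.le
    _ ≤ (M : ℝ) ^ (1 - s) * (M : ℝ) ^ s := by
      gcongr
      calc (2 : ℝ) ^ s ≤ 2 ^ (1 : ℝ) := by gcongr; norm_num
        _ = 2 := Real.rpow_one 2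
        _ ≤ _ := hM1
    _ = M := by rw [← Real.rpow_add hM0]; simp

theorem floor_mul_pow_succ_ediv {M : ℕ} (hM : 0 < M) (y : ℝ) (n : ℕ) :
    ⌊y * (M : ℝ) ^ (n + 1)⌋ / (M : ℤ) = ⌊y * (M : ℝ) ^ n⌋ := by
  rw [← Int.floor_div_natCast, pow_succ, ← mul_assoc, mul_div_cancel_right₀]
  exact_mod_cast hM.ne'

/-- In every interval and for every `s < 1`, `[0, 1)` is the image under an
`s`-Hölder map of a set of uniformly badly approximable numbers; `φ` is a right inverse of that
map. -/
theorem exists_badlyApproximable_family (α : ℝ) {L s : ℝ} (hL : 0 < L) (hs0 : 0 ≤ s)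
    (hs1 : s < 1) :
    ∃ c : ℝ, 0 < c ∧ ∃ C : ℝ, 0 ≤ C ∧ ∃ φ : ℝ → ℝ, ∀ y ∈ Ico (0 : ℝ) 1,
      φ y ∈ Icc α (α + L) ∧ (∀ p q : ℤ, 1 ≤ q → c / (q : ℝ) ^ 2 ≤ |φ y - p / q|) ∧
      ∀ y' ∈ Ico (0 : ℝ) 1, |y - y'| ≤ C * |φ y - φ y'| ^ s := by
  obtain ⟨M, hM2, hMb, hMs⟩ := exists_nat_rpow_le (1 / (2 * L)) hs0 hs1
  have hM0 : (0 : ℝ) < M := by positivity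
  have hM0' : (0 : ℤ) < M := by positivity
  set R : ℝ := M + 2 with hR
  have hR1 : 1 < R := by linarith
  have hR0 : 0 < R := by linarith
  have hRL : 1 ≤ 2 * L * R := by
    have : 1 / (2 * L) ≤ R := by linarith
    rwa [div_le_iff₀' (by positivity)] at this
  choose K hK using fun (n : ℕ) (a : ℤ) =>
    exists_subintervals_avoiding_rationals α hL hR1.le n a
  let pos (y : ℝ) (n : ℕ) : ℤ := cantorPosition M K n ⌊y * (M : ℝ) ^ n⌋
  have pos_mem (y : ℝ) (n : ℕ) :
      (pos y n : ℝ) * R ≤ pos y (n + 1) ∧ (pos y (n + 1) : ℝ) + 1 ≤ pos y n * R + R := by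
    have h := cantorPosition_succ_mem (K := K) hM0' n ⌊y * (M : ℝ) ^ (n + 1)⌋
    rw [floor_mul_pow_succ_ediv (by lia)] at h
    simp only [hR, pos]
    exact_mod_cast h
  have length_succ (n : ℕ) : L / R ^ n = R * (L / R ^ (n + 1)) := by rw [pow_succ]; field_simp
  let left (y : ℝ) (n : ℕ) : ℝ := α + pos y n * (L / R ^ n)
  let right (y : ℝ) (n : ℕ) : ℝ := α + (pos y n + 1) * (L / R ^ n)
  let φ (y : ℝ) : ℝ := ⨆ n, left y n
  have φ_mem (y : ℝ) (n : ℕ) : φ y ∈ Icc (left y n) (right y n) := by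
    refine mem_iInter.1 (Monotone.ciSup_mem_iInter_Icc_of_antitone
      (monotone_nat_of_le_succ fun n => ?_) (antitone_nat_of_succ_le fun n => ?_) fun n => ?_) n
    · have := mul_le_mul_of_nonneg_right (pos_mem y n).1 (by positivity : 0 ≤ L / R ^ (n + 1))
      simp only [left, length_succ n]
      linarith
    · have := mul_le_mul_of_nonneg_right (pos_mem y n).2 (by positivity : 0 ≤ L / R ^ (n + 1))
      simp only [right, length_succ n]
      linarith
    · have : 0 ≤ L / R ^ n := by positivity
      simp only [left, right]
      linarith
  have expand (y y' : ℝ) (n : ℕ) (h : |φ y - φ y'| ≤ L / R ^ n) :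
      |y - y'| ≤ 3 / (M : ℝ) ^ n := by
    wlog hyy : y' ≤ y generalizing y y'
    · rw [abs_sub_comm]
      exact this y' y (by rwa [abs_sub_comm]) (le_of_not_ge hyy)
    have hℓ : 0 < L / R ^ n := by positivity
    have h1 := (φ_mem y n).1
    have h2 := (φ_mem y' n).2
    have h3 := (abs_le.1 h).2
    simp only [left, right] at h1 h2
    have h4 : (pos y n : ℝ) ≤ pos y' n + 2 := by
      refine le_of_mul_le_mul_right ?_ hℓ
      linarith
    have h5 : pos y n ≤ pos y' n + 2 := by exact_mod_cast h4
    have h6 : ⌊y * (M : ℝ) ^ n⌋ ≤ ⌊y' * (M : ℝ) ^ n⌋ + 2 := by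
      by_contra! hlt
      have hmono := strictMono_cantorPosition (K := K) hM0' n
      have e1 : pos y' n < _ := hmono (lt_add_one _)
      have e2 := hmono (lt_add_one (⌊y' * (M : ℝ) ^ n⌋ + 1))
      have e3 : _ < pos y n := hmono (show ⌊y' * (M : ℝ) ^ n⌋ + 1 + 1 < ⌊y * (M : ℝ) ^ n⌋ by lia)
      lia
    have h7 : (⌊y * (M : ℝ) ^ n⌋ : ℝ) ≤ ⌊y' * (M : ℝ) ^ n⌋ + 2 := by exact_mod_cast h6
    have h8 := Int.lt_floor_add_one (y * (M : ℝ) ^ n)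
    have h9 := Int.floor_le (y' * (M : ℝ) ^ n)
    rw [abs_of_nonneg (sub_nonneg.2 hyy), le_div_iff₀ (by positivity)]
    linarith
  have φ_mem_Icc (y : ℝ) (hy : y ∈ Ico (0 : ℝ) 1) : φ y ∈ Icc α (α + L) := by
    have h0 : pos y 0 = 0 := by simpa [pos, cantorPosition, Int.floor_eq_iff] using hy
    simpa [left, right, h0] using φ_mem y 0
  refine ⟨1 / (4 * R ^ 2), by positivity, 3 * (R / L) ^ s, by positivity, φ,
    fun y hy => ⟨φ_mem_Icc y hy, fun p q hq => ?_, fun y' hy' => ?_⟩⟩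
  · have hq1 : (1 : ℝ) ≤ (q : ℝ) ^ 2 := one_le_pow₀ (by exact_mod_cast hq)
    obtain ⟨n, hn, hn'⟩ : ∃ n : ℕ, R ^ n ≤ 2 * L * q ^ 2 * R ∧ 2 * L * q ^ 2 * R < R ^ (n + 1) := by
      refine exists_nat_pow_near (hRL.trans ?_) hR1
      nlinarith [mul_pos hL hR0]
    have hn'' : 2 * L * q ^ 2 < R ^ n := by
      rw [pow_succ] at hn'
      exact lt_of_mul_lt_mul_right hn' hR0.le
    have havoid := cantorPosition_succ_avoids (M := M) (K := K) n ⌊y * (M : ℝ) ^ (n + 1)⌋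
    rw [floor_mul_pow_succ_ediv (by lia)] at havoid
    exact hK n (pos y n) (pos y (n + 1)) (pos_mem y n).1 (pos_mem y n).2 havoid (φ y)
      (φ_mem y (n + 1)).1 (φ_mem y (n + 1)).2 p q hq hn hn''
  · have hφ1 := φ_mem_Icc y hy
    have hφ2 := φ_mem_Icc y' hy'
    have hφL : |φ y - φ y'| ≤ L := by
      rw [abs_le]
      constructor <;> linarith [hφ1.1, hφ1.2, hφ2.1, hφ2.2]
    set δ := |φ y - φ y'| with hδ
    rcases (abs_nonneg (φ y - φ y')).eq_or_lt with h0 | hpos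
    · have hle (n : ℕ) : |y - y'| ≤ 3 / (M : ℝ) ^ n :=
        expand y y' n (by rw [← h0]; positivity)
      have hlim : Filter.Tendsto (fun n : ℕ => 3 / (M : ℝ) ^ n) Filter.atTop (nhds 0) :=
        Filter.Tendsto.const_div_atTop
          (tendsto_pow_atTop_atTop_of_one_lt (by exact_mod_cast hM2)) 3
      exact (ge_of_tendsto' hlim hle).trans (by positivity)
    · obtain ⟨n, hn, hn'⟩ := exists_nat_pow_near ((one_le_div hpos).2 hφL) hR1
      refine (expand y y' n ?_).trans ?_
      · rw [le_div_comm₀ hpos (by positivity)]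
        exact hn
      · rw [mul_assoc, ← Real.mul_rpow (by positivity) hpos.le, div_eq_mul_inv]
        gcongr
        calc ((M : ℝ) ^ n)⁻¹ ≤ ((R ^ s) ^ n)⁻¹ := by gcongr
          _ = ((R ^ n)⁻¹) ^ s := by
            rw [Real.inv_rpow (by positivity), ← Real.rpow_natCast, ← Real.rpow_natCast,
              ← Real.rpow_mul hR0.le, ← Real.rpow_mul hR0.le, mul_comm]
          _ ≤ (R / L * δ) ^ s := by
            gcongr
            rw [div_lt_iff₀ hpos, pow_succ] at hn'
            rw [inv_le_iff_one_le_mul₀ (by positivity), div_mul_eq_mul_div, div_mul_eq_mul_div,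
              one_le_div hL]
            linarith

end BadlyApproximable

section BoundedOrbits

open Set MeasureTheory

/-- Boundedness of the forward orbit is governed by the slope of the first row: if `x` is badly
approximable and the first row of `g` is `(x * b, b)`, then the forward orbit is bounded. -/
theorem exists_le_euclNorm2_of_badlyApproximable {g : Fin 2 → Fin 2 → ℝ} (hg : isSL2 g)
    {x c : ℝ} (hc : 0 < c) (hx : ∀ p q : ℤ, 1 ≤ q → c / (q : ℝ) ^ 2 ≤ |x - p / q|)
    (hgb : g 0 1 ≠ 0) (hgx : g 0 0 = x * g 0 1) :
    ∃ ε : ℝ, 0 < ε ∧ ∀ t : ℝ, 0 ≤ t → ∀ m : Fin 2 → ℤ, m ≠ 0 →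
      ε ≤ euclNorm2 (matVec (btMul t g) fun i => (m i : ℝ)) := by
  set b := g 0 1
  set d := g 1 1
  have hb : 0 < |b| := abs_pos.2 hgb
  obtain ⟨ε, hε0, hε1, hε2⟩ : ∃ ε : ℝ, 0 < ε ∧ ε ≤ |b| ∧ ε ^ 2 * (|d| + |b|) < c * |b| := by
    have hcont : ContinuousAt (fun ε : ℝ => ε ^ 2 * (|d| + |b|)) 0 := by fun_prop
    have h1 : ∀ᶠ ε : ℝ in nhds 0, ε ^ 2 * (|d| + |b|) < c * |b| :=
      hcont.eventually_lt continuousAt_const (by simpa using mul_pos hc hb)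
    have h2 : ∀ᶠ ε : ℝ in nhds 0, ε ≤ |b| := eventually_le_nhds hb
    obtain ⟨ε, ⟨h3, h4⟩, h5⟩ := (((h1.and h2).filter_mono nhdsWithin_le_nhds).and
      (self_mem_nhdsWithin : Ioi (0 : ℝ) ∈ nhdsWithin 0 (Ioi 0))).exists
    exact ⟨ε, h5, h4, h3⟩
  refine ⟨ε, hε0, fun t ht m hm => ?_⟩
  have approx (p q : ℤ) (hq : q ≠ 0) : c ≤ |(q : ℝ)| * |x * q + p| := by
    have pos_case (p q : ℤ) (hq : 1 ≤ q) : c ≤ |(q : ℝ)| * |x * q + p| := by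
      have hq0 : (0 : ℝ) < q := by exact_mod_cast hq
      have h := hx (-p) q hq
      rw [div_le_iff₀ (by positivity)] at h
      refine h.trans_eq ?_
      have : x * q + p = (x - (-p : ℤ) / q) * q := by push_cast; field_simp; ring
      rw [this, abs_mul, abs_of_pos hq0]
      ring
    rcases lt_or_gt_of_ne hq with h | h
    · have := pos_case (-p) (-q) (by lia)
      push_cast at this
      rw [abs_neg, show x * -(q : ℝ) + -p = -(x * q + p) by ring, abs_neg] at this
      exact this
    · exact pos_case p q h
  set u : ℝ := g 0 0 * m 0 + b * m 1 with hu
  set v : ℝ := g 1 0 * m 0 + d * m 1 with hv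
  have hnorm : euclNorm2 (matVec (btMul t g) fun i => (m i : ℝ)) =
      √((Real.exp t * u) ^ 2 + (Real.exp (-t) * v) ^ 2) := by
    simp only [euclNorm2, matVec, btMul, hu, hv, b, d]
    norm_num
    congr 1
    ring
  rw [hnorm]
  by_contra! hlt
  have hut : |Real.exp t * u| < ε :=
    (Real.abs_le_sqrt (le_add_of_nonneg_right (sq_nonneg _))).trans_lt hlt
  have hvt : |Real.exp (-t) * v| < ε :=
    (Real.abs_le_sqrt (le_add_of_nonneg_left (sq_nonneg _))).trans_lt hlt
  have het : 1 ≤ Real.exp t := Real.one_le_exp ht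
  have hetn : Real.exp (-t) ≤ 1 := Real.exp_le_one_iff.2 (by linarith)
  have hee : Real.exp t * Real.exp (-t) = 1 := by rw [← Real.exp_add]; simp
  rw [abs_mul, Real.abs_exp] at hut hvt
  have hu' : u = b * (x * m 0 + m 1) := by rw [hu, hgx]; ring
  by_cases hm0 : m 0 = 0
  · have hm1 : m 1 ≠ 0 := by
      intro hm1
      apply hm
      ext i
      fin_cases i <;> simp [hm0, hm1]
    have h1 : (1 : ℝ) ≤ |(m 1 : ℝ)| := by exact_mod_cast Int.one_le_abs hm1
    have h2 : |b| ≤ |u| := by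
      rw [hu', hm0, abs_mul]
      simpa using le_mul_of_one_le_right hb.le h1
    have h3 : |u| ≤ Real.exp t * |u| := le_mul_of_one_le_left (abs_nonneg _) het
    linarith
  · have hbad := approx (m 1) (m 0) hm0
    have hm0_eq : (m 0 : ℝ) = d * u - b * v := by
      have hg' : g 0 0 * d - b * g 1 0 = 1 := hg
      rw [hu, hv]
      linear_combination (-(m 0 : ℝ)) * hg'
    have hm0_le : |(m 0 : ℝ)| ≤ |d| * |u| + |b| * |v| := by
      rw [hm0_eq, ← abs_mul, ← abs_mul]
      exact abs_sub _ _
    have huu : |u| = |b| * |x * m 0 + m 1| := by rw [hu', abs_mul]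
    have h1 : c * |b| ≤ |(m 0 : ℝ)| * |u| := by
      rw [huu]
      nlinarith
    have h2 : |u| * |u| ≤ ε ^ 2 := by
      have h3 : |u| ≤ ε := (le_mul_of_one_le_left (abs_nonneg u) het).trans hut.le
      nlinarith [abs_nonneg u]
    have h3 : |v| * |u| ≤ ε ^ 2 := by
      calc |v| * |u| = Real.exp t * Real.exp (-t) * (|v| * |u|) := by rw [hee, one_mul]
        _ = (Real.exp (-t) * |v|) * (Real.exp t * |u|) := by ring
        _ ≤ ε * ε := by gcongr
        _ = ε ^ 2 := by ring
    have h4 : |(m 0 : ℝ)| * |u| ≤ (|d| * |u| + |b| * |v|) * |u| := by gcongr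
    have h5 : |d| * (|u| * |u|) ≤ |d| * ε ^ 2 := by gcongr
    have h6 : |b| * (|v| * |u|) ≤ |b| * ε ^ 2 := by gcongr
    linarith

/-- The affine group `SL(2,ℝ) × ℝ²` has Hausdorff dimension at most `5`. -/
theorem dimH_isSL2_prod_le :
    dimH {p : (Fin 2 → Fin 2 → ℝ) × (Fin 2 → ℝ) | isSL2 p.1} ≤ 5 := by
  let fRight (σ : ℝ) (p : Fin 5 → ℝ) : (Fin 2 → Fin 2 → ℝ) × (Fin 2 → ℝ) :=
    (![![p 0, σ * Real.exp (p 1)], ![(p 0 * p 2 - 1) * (σ * Real.exp (-p 1)), p 2]],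
      ![p 3, p 4])
  let fLeft (σ : ℝ) (p : Fin 5 → ℝ) : (Fin 2 → Fin 2 → ℝ) × (Fin 2 → ℝ) :=
    (![![σ * Real.exp (p 1), p 0], ![p 2, (1 + p 0 * p 2) * (σ * Real.exp (-p 1))]],
      ![p 3, p 4])
  have dim_range {f : (Fin 5 → ℝ) → (Fin 2 → Fin 2 → ℝ) × (Fin 2 → ℝ)} (hf : ContDiff ℝ 1 f) :
      dimH (range f) ≤ 5 := by
    simpa using hf.dimH_range_le
  have fRight_smooth (σ : ℝ) : ContDiff ℝ 1 (fRight σ) := by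
    refine ContDiff.prodMk (contDiff_pi.2 fun i => contDiff_pi.2 fun j => ?_)
      (contDiff_pi.2 fun i => ?_)
    · fin_cases i <;> fin_cases j <;> simp <;> fun_prop
    · fin_cases i <;> simp <;> fun_prop
  have fLeft_smooth (σ : ℝ) : ContDiff ℝ 1 (fLeft σ) := by
    refine ContDiff.prodMk (contDiff_pi.2 fun i => contDiff_pi.2 fun j => ?_)
      (contDiff_pi.2 fun i => ?_)
    · fin_cases i <;> fin_cases j <;> simp <;> fun_prop
    · fin_cases i <;> simp <;> fun_prop
  have exists_exp (b : ℝ) (hb : b ≠ 0) : ∃ σ u : ℝ, (σ = 1 ∨ σ = -1) ∧ b = σ * Real.exp u ∧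
      b⁻¹ = σ * Real.exp (-u) := by
    rcases lt_or_gt_of_ne hb with h | h
    · refine ⟨-1, Real.log (-b), Or.inr rfl, ?_, ?_⟩
      · rw [Real.exp_log (by linarith)]; ring
      · rw [Real.exp_neg, Real.exp_log (by linarith), inv_neg]; ring
    · refine ⟨1, Real.log b, Or.inl rfl, ?_, ?_⟩
      · rw [Real.exp_log h]; ring
      · rw [Real.exp_neg, Real.exp_log h]; ring
  have hcover : {p : (Fin 2 → Fin 2 → ℝ) × (Fin 2 → ℝ) | isSL2 p.1} ⊆
      (range (fRight 1) ∪ range (fRight (-1))) ∪ (range (fLeft 1) ∪ range (fLeft (-1))) := by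
    rintro ⟨g, w⟩ hg
    replace hg : g 0 0 * g 1 1 - g 0 1 * g 1 0 = 1 := hg
    by_cases hb : g 0 1 = 0
    · have ha : g 0 0 ≠ 0 := by
        intro ha
        simp [ha, hb] at hg
      obtain ⟨σ, u, hσ, h1, h2⟩ := exists_exp _ ha
      right
      have : fLeft σ ![g 0 1, u, g 1 0, w 0, w 1] = (g, w) := by
        ext i j
        · fin_cases i <;> fin_cases j <;> simp [fLeft, ← h1, ← h2]
          field_simp
          linarith
        · fin_cases i <;> simp [fLeft]
      rcases hσ with rfl | rfl
      · exact Or.inl ⟨_, this⟩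
      · exact Or.inr ⟨_, this⟩
    · obtain ⟨σ, u, hσ, h1, h2⟩ := exists_exp _ hb
      left
      have : fRight σ ![g 0 0, u, g 1 1, w 0, w 1] = (g, w) := by
        ext i j
        · fin_cases i <;> fin_cases j <;> simp [fRight, ← h1, ← h2]
          field_simp
          linarith
        · fin_cases i <;> simp [fRight]
      rcases hσ with rfl | rfl
      · exact Or.inl ⟨_, this⟩
      · exact Or.inr ⟨_, this⟩
  refine (dimH_mono hcover).trans ?_
  simp only [dimH_union]
  exact max_le (max_le (dim_range (fRight_smooth _)) (dim_range (fRight_smooth _)))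
    (max_le (dim_range (fLeft_smooth _)) (dim_range (fLeft_smooth _)))

/-- An open set meeting `SL(2,ℝ) × ℝ²` meets it at a point whose upper right entry is nonzero. -/
theorem exists_isSL2_mem_upperRight_ne_zero {U : Set ((Fin 2 → Fin 2 → ℝ) × (Fin 2 → ℝ))}
    (hU : IsOpen U) (hne : (U ∩ {p | isSL2 p.1}).Nonempty) :
    ∃ p ∈ U, isSL2 p.1 ∧ p.1 0 1 ≠ 0 := by
  obtain ⟨⟨g, w⟩, hgU, hg⟩ := hne
  replace hg : g 0 0 * g 1 1 - g 0 1 * g 1 0 = 1 := hg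
  by_cases hb : g 0 1 = 0
  swap
  · exact ⟨(g, w), hgU, hg, hb⟩
  have ha : g 0 0 ≠ 0 := by
    intro ha
    simp [ha, hb] at hg
  let shear (t : ℝ) : (Fin 2 → Fin 2 → ℝ) × (Fin 2 → ℝ) :=
    (fun i j => g i j + if j = 1 then t * g i 0 else 0, w)
  have hshear : Continuous shear := by
    refine Continuous.prodMk (continuous_pi fun i => continuous_pi fun j => ?_) continuous_const
    split_ifs <;> fun_prop
  have h0 : shear 0 ∈ U := by simpa [shear] using hgU
  have hnear : ∀ᶠ t in nhdsWithin (0 : ℝ) {0}ᶜ, shear t ∈ U :=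
    (hshear.continuousAt.eventually_mem (hU.mem_nhds h0)).filter_mono nhdsWithin_le_nhds
  obtain ⟨t, htU, ht⟩ := (hnear.and self_mem_nhdsWithin).exists
  refine ⟨shear t, htU, ?_, ?_⟩
  · simp [shear, isSL2]
    linarith
  · simpa [shear, hb] using ⟨ht, ha⟩

/-- The chart of `SL(2,ℝ) × ℝ²` whose coordinates are the slope of the first row, the two entries of
the second column, and the translation. -/
noncomputable def slopeChart (p : Fin 5 → ℝ) : (Fin 2 → Fin 2 → ℝ) × (Fin 2 → ℝ) :=
  (![![p 0 * p 1, p 1], ![p 0 * p 2 - (p 1)⁻¹, p 2]], ![p 3, p 4])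

theorem isSL2_slopeChart {p : Fin 5 → ℝ} (hp : p 1 ≠ 0) : isSL2 (slopeChart p).1 := by
  simp [isSL2, slopeChart]
  field_simp
  ring

theorem continuousAt_slopeChart {p : Fin 5 → ℝ} (hp : p 1 ≠ 0) : ContinuousAt slopeChart p := by
  have hinv : ContinuousAt (fun q : Fin 5 → ℝ => (q 1)⁻¹) p :=
    (continuous_apply 1).continuousAt.inv₀ hp
  have happ (i : Fin 5) : ContinuousAt (fun q : Fin 5 → ℝ => q i) p :=
    (continuous_apply i).continuousAt
  refine ContinuousAt.prodMk (continuousAt_pi.2 fun i => continuousAt_pi.2 fun j => ?_)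
    (continuousAt_pi.2 fun i => ?_)
  · fin_cases i <;> fin_cases j
    exacts [(happ 0).mul (happ 1), happ 1, ((happ 0).mul (happ 2)).sub hinv, happ 2]
  · fin_cases i
    exacts [happ 3, happ 4]

theorem abs_sub_le_dist_slopeChart (p q : Fin 5 → ℝ) {i : Fin 5} (hi : i ≠ 0) :
    |p i - q i| ≤ dist (slopeChart p) (slopeChart q) := by
  have hfst (j k : Fin 2) : dist ((slopeChart p).1 j k) ((slopeChart q).1 j k) ≤
      dist (slopeChart p) (slopeChart q) :=
    ((dist_le_pi_dist _ _ k).trans (dist_le_pi_dist _ _ j)).trans (le_max_left _ _)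
  have hsnd (j : Fin 2) : dist ((slopeChart p).2 j) ((slopeChart q).2 j) ≤
      dist (slopeChart p) (slopeChart q) :=
    (dist_le_pi_dist _ _ j).trans (le_max_right _ _)
  fin_cases i
  · exact absurd rfl hi
  · exact hfst 0 1
  · exact hfst 1 1
  · exact hsnd 0
  · exact hsnd 1

theorem abs_slope_sub_le_dist_slopeChart {p q : Fin 5 → ℝ} {A β : ℝ} (hβ : 0 < β)
    (hp : β ≤ |p 1|) (hq : |q 0| ≤ A) :
    |p 0 - q 0| ≤ (1 + A) / β * dist (slopeChart p) (slopeChart q) := by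
  have h1 : |p 0 * p 1 - q 0 * q 1| ≤ dist (slopeChart p) (slopeChart q) :=
    ((dist_le_pi_dist ((slopeChart p).1 0) ((slopeChart q).1 0) 0).trans
      (dist_le_pi_dist (slopeChart p).1 (slopeChart q).1 0)).trans (le_max_left _ _)
  have h2 := abs_sub_le_dist_slopeChart p q (i := 1) (by decide)
  set D := dist (slopeChart p) (slopeChart q)
  have h3 : |p 0 - q 0| * |p 1| ≤ D + A * D := by
    calc |p 0 - q 0| * |p 1| = |(p 0 * p 1 - q 0 * q 1) - q 0 * (p 1 - q 1)| := by
          rw [← abs_mul]; ring_nf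
      _ ≤ |p 0 * p 1 - q 0 * q 1| + |q 0| * |p 1 - q 1| := by
          rw [← abs_mul]; exact abs_sub _ _
      _ ≤ D + A * D := by gcongr; exact (abs_nonneg _).trans hq
  rw [div_mul_eq_mul_div, le_div_iff₀ hβ]
  calc |p 0 - q 0| * β ≤ |p 0 - q 0| * |p 1| := by gcongr
    _ ≤ _ := h3
    _ = _ := by ring

open scoped NNReal ENNReal in
/-- Near any point of `SL(2,ℝ) × ℝ²` with nonzero upper right entry there are bounded
orbits forming a set of dimension at least `4 + s`, for every `s < 1`. -/
theorem four_add_le_dimH_bounded_orbits {U : Set ((Fin 2 → Fin 2 → ℝ) × (Fin 2 → ℝ))}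
    (hU : IsOpen U) {p₀ : (Fin 2 → Fin 2 → ℝ) × (Fin 2 → ℝ)} (hp₀U : p₀ ∈ U)
    (hp₀ : isSL2 p₀.1) (hb : p₀.1 0 1 ≠ 0) {s : ℝ≥0} (hs0 : 0 < s) (hs1 : s < 1) :
    ((4 + s : ℝ≥0) : ℝ≥0∞) ≤ dimH ({p : (Fin 2 → Fin 2 → ℝ) × (Fin 2 → ℝ) |
      isSL2 p.1 ∧ ∃ ε : ℝ, 0 < ε ∧ ∀ t : ℝ, 0 ≤ t → ∀ m : Fin 2 → ℤ, m ≠ 0 →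
        ε ≤ euclNorm2 (matVec (btMul t p.1) fun i => (m i : ℝ))} ∩ U) := by
  obtain ⟨g, w⟩ := p₀
  replace hp₀ : g 0 0 * g 1 1 - g 0 1 * g 1 0 = 1 := hp₀
  replace hb : g 0 1 ≠ 0 := hb
  set z : Fin 5 → ℝ := ![g 0 0 / g 0 1, g 0 1, g 1 1, w 0, w 1] with hz
  have hz1 : z 1 ≠ 0 := hb
  have hzchart : slopeChart z = (g, w) := by
    ext i j
    · fin_cases i <;> fin_cases j <;> simp [slopeChart, hz] <;> field_simp
      linarith
    · fin_cases i <;> simp [slopeChart, hz]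
  obtain ⟨δ, hδ, hδU⟩ : ∃ δ > 0, Metric.closedBall z δ ⊆
      slopeChart ⁻¹' U ∩ {p | |z 1| / 2 < |p 1|} := by
    refine Metric.nhds_basis_closedBall.mem_iff.1 (Filter.inter_mem ?_ ?_)
    · exact (continuousAt_slopeChart hz1).preimage_mem_nhds
        (hU.mem_nhds (by rw [hzchart]; exact hp₀U))
    · exact (isOpen_lt continuous_const (by fun_prop)).mem_nhds
        (half_lt_self (abs_pos.2 hz1))
  obtain ⟨c, hc, C, hC, φ, hφ⟩ :=
    exists_badlyApproximable_family (z 0) hδ s.coe_nonneg (by exact_mod_cast hs1)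
  let B : Set (Fin 5 → ℝ) :=
    Set.pi univ fun i => if i = 0 then Ico 0 1 else Icc (z i) (z i + δ)
  let param (p : Fin 5 → ℝ) : Fin 5 → ℝ := fun i => if i = 0 then φ (p 0) else p i
  have mem_zero {p} (hp : p ∈ B) : p 0 ∈ Ico (0 : ℝ) 1 := by simpa using hp 0 (mem_univ _)
  have mem_Icc {p} (hp : p ∈ B) (i : Fin 5) : param p i ∈ Icc (z i) (z i + δ) := by
    by_cases hi : i = 0
    · subst hi
      simpa [param] using (hφ _ (mem_zero hp)).1
    · simpa [param, hi] using hp i (mem_univ _)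
  have param_mem {p} (hp : p ∈ B) : param p ∈ Metric.closedBall z δ := by
    refine (dist_pi_le_iff hδ.le).2 fun i => ?_
    have := mem_Icc hp i
    rw [Real.dist_eq, abs_of_nonneg] <;> linarith [this.1, this.2]
  set A : ℝ := |z 0| + δ
  set D : ℝ := C * ((1 + A) / (|z 1| / 2)) ^ (s : ℝ) + 1 with hD
  have hA : 0 ≤ A := by positivity
  have hz1' : 0 < |z 1| / 2 := half_pos (abs_pos.2 hz1)
  have hD0 : 0 ≤ D := by positivity
  have hsum : ∑ i : Fin 5, (if i = 0 then s else 1 : ℝ≥0) = 4 + s := by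
    simp [Fin.sum_univ_succ]
    ring
  rw [← hsum]
  refine sum_le_dimH_of_edist_le (B := B) (F := fun p => slopeChart (param p))
    (C := D.toNNReal) ?_ ?_ ?_
  · rw [volume_pi_pi, Finset.prod_ne_zero_iff]
    intro i _
    split_ifs <;> simp [hδ]
  · intro p hp
    have hmem := hδU (param_mem hp)
    have hne : param p 1 ≠ 0 := abs_pos.1 (hz1'.trans hmem.2)
    exact ⟨⟨isSL2_slopeChart hne, exists_le_euclNorm2_of_badlyApproximable
      (isSL2_slopeChart hne) hc (hφ _ (mem_zero hp)).2.1 hne rfl⟩, hmem.1⟩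
  · intro p hp p' hp' i
    rw [edist_dist, edist_dist, ENNReal.ofReal_rpow_of_nonneg dist_nonneg (by positivity),
      ← ENNReal.ofReal_coe_nnreal, ← ENNReal.ofReal_mul (by positivity), Real.coe_toNNReal _ hD0]
    refine ENNReal.ofReal_le_ofReal ?_
    rw [Real.dist_eq]
    by_cases hi : i = 0
    · subst hi
      have hslope := abs_slope_sub_le_dist_slopeChart hz1' (hδU (param_mem hp)).2.le
        (show |param p' 0| ≤ A by
          have := mem_Icc hp' 0
          rw [abs_le]
          constructor <;> linarith [this.1, this.2, neg_abs_le (z 0), le_abs_self (z 0)])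
      have hexp := (hφ _ (mem_zero hp)).2.2 _ (mem_zero hp')
      set E := dist (slopeChart (param p)) (slopeChart (param p'))
      have hE : 0 ≤ E := dist_nonneg
      calc |p 0 - p' 0| ≤ C * ((1 + A) / (|z 1| / 2) * E) ^ (s : ℝ) :=
            hexp.trans (by gcongr; exact hslope)
        _ = C * ((1 + A) / (|z 1| / 2)) ^ (s : ℝ) * E ^ (s : ℝ) := by
            rw [Real.mul_rpow (by positivity) hE, mul_assoc]
        _ ≤ D * E ^ (s : ℝ) := by
            gcongr
            linarith
    · have h := abs_sub_le_dist_slopeChart (param p) (param p') hi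
      simp only [param, if_neg hi] at h
      have hD1 : 1 ≤ D := le_add_of_nonneg_left (by positivity)
      simp only [if_neg hi, NNReal.coe_one, Real.rpow_one]
      exact h.trans (le_mul_of_one_le_left dist_nonneg hD1)

end BoundedOrbits

/-- The set of `(g,w) ∈ SL(2,ℝ) × ℝ²` whose forward diagonal orbit is bounded (by
Mahler's criterion: `‖b_t g m‖ ≥ ε` for all `t ≥ 0` and nonzero `m ∈ ℤ²`) is thick:
full Hausdorff dimension `5` in every open set meeting `SL(2,ℝ) × ℝ²`. -/
theorem stmt15 :
    ∀ U : Set ((Fin 2 → Fin 2 → ℝ) × (Fin 2 → ℝ)), IsOpen U →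
      (U ∩ {p | isSL2 p.1}).Nonempty →
      dimH ({p : (Fin 2 → Fin 2 → ℝ) × (Fin 2 → ℝ) |
          isSL2 p.1 ∧ ∃ ε : ℝ, 0 < ε ∧ ∀ t : ℝ, 0 ≤ t → ∀ m : Fin 2 → ℤ, m ≠ 0 →
            ε ≤ euclNorm2 (matVec (btMul t p.1) fun i => (m i : ℝ))} ∩ U) = 5 := by
  intro U hU hne
  apply le_antisymm
  · exact (dimH_mono fun p hp => hp.1.1).trans dimH_isSL2_prod_le
  · obtain ⟨p₀, hp₀U, hp₀, hb⟩ := exists_isSL2_mem_upperRight_ne_zero hU hne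
    refine ENNReal.le_of_forall_nnreal_lt fun r hr => ?_
    have hr5 : r < 5 := by exact_mod_cast hr
    have hr4 : r - 4 < 1 := by
      rw [← NNReal.coe_lt_coe] at hr5 ⊢
      rw [NNReal.coe_sub_def]
      push_cast at hr5 ⊢
      exact max_lt (by linarith) one_pos
    obtain ⟨s, hs, hs1⟩ := exists_between (max_lt (zero_lt_one' NNReal) hr4)
    refine le_trans ?_ (four_add_le_dimH_bounded_orbits hU hp₀U hp₀ hb
      ((le_max_left _ _).trans_lt hs) hs1)
    have hrs : r ≤ 4 + s := tsub_le_iff_left.1 ((le_max_right _ _).trans hs.le)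
    exact_mod_cast hrs
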